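/- For every integer m ≥ 2, 𝔼(Π̂(m+1)) − 𝔼(Π̂(m)) = (1 − 1/(m+1)) 𝔼(y_{m+1}). -/

import Mathlib

open MeasureTheory Filter Finset Asymptotics
open scoped Classical

/-- `y_m(α) = ∏_{j ∈ α, j < m} (1 - 1/j)` (empty product = 1). -/
noncomputable def hawkinsY (A : Set ℕ) (m : ℕ) : ℝ :=
  ∏ j ∈ Finset.range m, if j ∈ A then 1 - 1 / (j : ℝ) else 1

/-- The σ-algebra generated by the events `{j ∈ α}` for `2 ≤ j < m`. -/
def sieveSigma {Ω : Type*} (α : Ω → Set ℕ) (m : ℕ) : MeasurableSpace Ω :=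
  MeasurableSpace.generateFrom {s | ∃ j : ℕ, 2 ≤ j ∧ j < m ∧ s = {ω | j ∈ α ω}}

/-- Wunderlich's model of the Hawkins random sieve: a probability space `(Ω, μ)` with a
random subset `α` of `{2,3,4,…}` such that `μ(2 ∈ α) = 1` and, for every `m ≥ 2`, the
conditional probability of `{m ∈ α}` given the σ-algebra generated by the events
`{j ∈ α}`, `2 ≤ j < m`, equals `y_m(α)`. -/
structure IsHawkinsSieve {Ω : Type*} [MeasurableSpace Ω] (μ : Measure Ω)
    (α : Ω → Set ℕ) : Prop where
  isProb : IsProbabilityMeasure μ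
  meas : ∀ n : ℕ, MeasurableSet {ω | n ∈ α ω}
  mem_ge_two : ∀ ω, ∀ n ∈ α ω, 2 ≤ n
  two_mem : μ {ω | 2 ∈ α ω} = 1
  condExp_mem : ∀ m : ℕ, 2 ≤ m →
    μ[Set.indicator {ω | m ∈ α ω} (fun _ => (1 : ℝ)) | sieveSigma α m]
      =ᵐ[μ] fun ω => hawkinsY (α ω) m

/-- `M_k = 1 + ∑_{j=1}^{k-2} 1/j` (so `M_2 = 1`). -/
noncomputable def Mharm (k : ℕ) : ℝ := 1 + ∑ j ∈ Finset.Icc 1 (k - 2), 1 / (j : ℝ)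

/-- `Π̂(x; α) = Σ_{m ≤ x, m ∈ α, m+2 ∈ α} (y_m(α) - (1/(m+1))(1 - 1/m) y_m(α)^2)⁻¹`. -/
noncomputable def piHat (A : Set ℕ) (x : ℕ) : ℝ :=
  ∑ m ∈ Finset.range (x + 1),
    if m ∈ A ∧ m + 2 ∈ A then
      (hawkinsY A m - (1 / ((m : ℝ) + 1)) * (1 - 1 / (m : ℝ)) * (hawkinsY A m) ^ 2)⁻¹
    else 0

/-- Bounded functions which are measurable for the sieve's history before `k`. -/
def IsBoundedBefore {Ω : Type*} (α : Ω → Set ℕ) (k : ℕ) (g : Ω → ℝ) : Prop :=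
  Measurable[sieveSigma α k] g ∧ ∃ C : ℝ, ∀ ω, |g ω| ≤ C

lemma sieveSigma_mono {Ω : Type*} (α : Ω → Set ℕ) {j k : ℕ} (hjk : j ≤ k) :
    sieveSigma α j ≤ sieveSigma α k :=
  MeasurableSpace.generateFrom_mono fun _ ⟨i, h2, hi, hs⟩ => ⟨i, h2, hi.trans_le hjk, hs⟩

lemma IsBoundedBefore.mono {Ω : Type*} {α : Ω → Set ℕ} {j k : ℕ} {g : Ω → ℝ}
    (hg : IsBoundedBefore α j g) (hjk : j ≤ k) : IsBoundedBefore α k g :=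
  ⟨hg.1.mono (sieveSigma_mono α hjk) le_rfl, hg.2⟩

lemma IsBoundedBefore.mul {Ω : Type*} {α : Ω → Set ℕ} {k : ℕ} {f g : Ω → ℝ}
    (hf : IsBoundedBefore α k f) (hg : IsBoundedBefore α k g) :
    IsBoundedBefore α k (fun ω => f ω * g ω) := by
  obtain ⟨hf, C, hC⟩ := hf
  obtain ⟨hg, D, hD⟩ := hg
  refine ⟨Measurable.mul hf hg, C * D, fun ω => ?_⟩
  rw [abs_mul]
  exact mul_le_mul (hC ω) (hD ω) (abs_nonneg _) ((abs_nonneg _).trans (hC ω))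

lemma isBoundedBefore_indicator {Ω : Type*} (α : Ω → Set ℕ) {j k : ℕ} (hj : 2 ≤ j)
    (hjk : j < k) :
    IsBoundedBefore α k (Set.indicator {ω | j ∈ α ω} (fun _ => (1 : ℝ))) := by
  refine ⟨?_, 1, fun ω => ?_⟩
  · refine Measurable.indicator measurable_const ?_
    exact MeasurableSpace.measurableSet_generateFrom ⟨j, hj, hjk, rfl⟩
  · by_cases hω : j ∈ α ω <;> simp [Set.indicator, hω]

lemma hawkinsY_succ (A : Set ℕ) (k : ℕ) :
    hawkinsY A (k + 1) = hawkinsY A k * if k ∈ A then 1 - 1 / (k : ℝ) else 1 := by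
  simp only [hawkinsY, Finset.prod_range_succ]

lemma finite_range_hawkinsY (k : ℕ) : (Set.range fun A => hawkinsY A k).Finite := by
  induction k with
  | zero => exact (Set.finite_singleton (1 : ℝ)).subset (by rintro _ ⟨A, rfl⟩; simp [hawkinsY])
  | succ k ih =>
    refine ((ih.image (· * (1 - 1 / (k : ℝ)))).union ih).subset ?_
    rintro _ ⟨A, rfl⟩
    by_cases hk : k ∈ A
    · exact Or.inl ⟨_, ⟨A, rfl⟩, by simp [hawkinsY_succ, hk]⟩
    · exact Or.inr ⟨A, by simp [hawkinsY_succ, hk]⟩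

lemma hawkinsY_mem_Ioc {A : Set ℕ} (hA : ∀ n ∈ A, 2 ≤ n) (k : ℕ) :
    hawkinsY A k ∈ Set.Ioc (0 : ℝ) 1 := by
  induction k with
  | zero => simp [hawkinsY]
  | succ k ih =>
    rw [hawkinsY_succ]
    split_ifs with hk
    · have h2 : (2 : ℝ) ≤ k := by exact_mod_cast hA k hk
      have hpos : (0 : ℝ) < 1 / k := by positivity
      have hlt : 1 / (k : ℝ) < 1 := by rw [div_lt_one] <;> linarith
      exact ⟨mul_pos ih.1 (by linarith), mul_le_one₀ ih.2 (by linarith) (by linarith)⟩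
    · simpa using ih

lemma measurable_hawkinsY {Ω : Type*} {α : Ω → Set ℕ} (hα : ∀ ω, ∀ n ∈ α ω, 2 ≤ n) (k : ℕ) :
    Measurable[sieveSigma α k] (fun ω => hawkinsY (α ω) k) := by
  unfold hawkinsY
  refine Finset.measurable_fun_prod _ fun j hj => ?_
  rw [Finset.mem_range] at hj
  by_cases h2 : 2 ≤ j
  · refine Measurable.ite ?_ measurable_const measurable_const
    exact MeasurableSpace.measurableSet_generateFrom ⟨j, h2, hj, rfl⟩
  · have : ∀ ω, j ∉ α ω := fun ω hω => h2 (hα ω j hω)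
    simp only [this, if_false]
    exact measurable_const

lemma isBoundedBefore_comp_hawkinsY {Ω : Type*} {α : Ω → Set ℕ}
    (hα : ∀ ω, ∀ n ∈ α ω, 2 ≤ n) (k : ℕ) {G : ℝ → ℝ} (hG : Measurable G) :
    IsBoundedBefore α k (fun ω => G (hawkinsY (α ω) k)) := by
  refine ⟨hG.comp (measurable_hawkinsY hα k), ?_⟩
  obtain ⟨C, hC⟩ := ((finite_range_hawkinsY k).image fun y => |G y|).bddAbove
  exact ⟨C, fun ω => hC ⟨_, ⟨α ω, rfl⟩, rfl⟩⟩

lemma piHat_summand_eq (A : Set ℕ) (n : ℕ) :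
    (if n ∈ A ∧ n + 2 ∈ A then
      (hawkinsY A n - (1 / ((n : ℝ) + 1)) * (1 - 1 / (n : ℝ)) * (hawkinsY A n) ^ 2)⁻¹
    else 0) = (if n ∈ A then 1 else 0) *
      (hawkinsY A n - (1 / ((n : ℝ) + 1)) * (1 - 1 / (n : ℝ)) * (hawkinsY A n) ^ 2)⁻¹ *
      (if n + 2 ∈ A then 1 else 0) := by
  by_cases h1 : n ∈ A <;> by_cases h2 : n + 2 ∈ A <;> simp [h1, h2]

lemma indicator_mem_apply {Ω : Type*} (α : Ω → Set ℕ) (j : ℕ) (ω : Ω) :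
    Set.indicator {ω | j ∈ α ω} (fun _ => (1 : ℝ)) ω = if j ∈ α ω then 1 else 0 := rfl

section

variable {Ω : Type*} [MeasurableSpace Ω] {μ : Measure Ω} {α : Ω → Set ℕ}

lemma IsHawkinsSieve.sieveSigma_le (h : IsHawkinsSieve μ α) (k : ℕ) :
    sieveSigma α k ≤ ‹MeasurableSpace Ω› :=
  MeasurableSpace.generateFrom_le fun _ ⟨j, _, _, hs⟩ => hs ▸ h.meas j

lemma IsHawkinsSieve.integrable (h : IsHawkinsSieve μ α) {k : ℕ} {g : Ω → ℝ}
    (hg : IsBoundedBefore α k g) : Integrable g μ := by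
  have := h.isProb
  obtain ⟨hg, C, hC⟩ := hg
  exact Integrable.of_bound (hg.mono (h.sieveSigma_le k) le_rfl).aestronglyMeasurable C
    (Eventually.of_forall hC)

lemma IsHawkinsSieve.integral_mul_indicator (h : IsHawkinsSieve μ α) {k : ℕ} (hk : 2 ≤ k)
    {g : Ω → ℝ} (hg : IsBoundedBefore α k g) :
    ∫ ω, g ω * Set.indicator {ω | k ∈ α ω} (fun _ => (1 : ℝ)) ω ∂μ =
      ∫ ω, g ω * hawkinsY (α ω) k ∂μ := by
  have := h.isProb
  have hI := isBoundedBefore_indicator α hk k.lt_succ_self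
  have hpull := condExp_mul_of_stronglyMeasurable_left (μ := μ) hg.1.stronglyMeasurable
    (h.integrable ((hg.mono k.le_succ).mul hI)) (h.integrable hI)
  rw [← integral_condExp (h.sieveSigma_le k)]
  refine integral_congr_ae ?_
  filter_upwards [hpull, h.condExp_mem k hk] with ω h1 h2
  rw [Pi.mul_apply, h2] at h1
  exact h1

/-- The weight of a twin pair `n`, `n + 2`, restricted to `n ∈ α`. -/
lemma IsHawkinsSieve.isBoundedBefore_weight (h : IsHawkinsSieve μ α) {n : ℕ} (hn : 2 ≤ n) :
    IsBoundedBefore α (n + 1) fun ω => (if n ∈ α ω then 1 else 0) *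
      (hawkinsY (α ω) n -
        (1 / ((n : ℝ) + 1)) * (1 - 1 / (n : ℝ)) * (hawkinsY (α ω) n) ^ 2)⁻¹ :=
  (isBoundedBefore_indicator α hn n.lt_succ_self).mul
    ((isBoundedBefore_comp_hawkinsY h.mem_ge_two n
      (G := fun y => (y - (1 / ((n : ℝ) + 1)) * (1 - 1 / (n : ℝ)) * y ^ 2)⁻¹)
      (by fun_prop)).mono n.le_succ)

lemma IsHawkinsSieve.integrable_summand (h : IsHawkinsSieve μ α) (n : ℕ) :
    Integrable (fun ω => if n ∈ α ω ∧ n + 2 ∈ α ω then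
      (hawkinsY (α ω) n -
        (1 / ((n : ℝ) + 1)) * (1 - 1 / (n : ℝ)) * (hawkinsY (α ω) n) ^ 2)⁻¹ else 0) μ := by
  by_cases hn : 2 ≤ n
  · simp only [piHat_summand_eq]
    exact h.integrable (((h.isBoundedBefore_weight hn).mono (by omega : n + 1 ≤ n + 3)).mul
      (isBoundedBefore_indicator α (by omega : 2 ≤ n + 2) (by omega)))
  · have : ∀ ω, n ∉ α ω := fun ω hω => hn (h.mem_ge_two ω n hω)
    simp [this]

lemma IsHawkinsSieve.integral_summand (h : IsHawkinsSieve μ α) {n : ℕ} (hn : 2 ≤ n) :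
    ∫ ω, (if n ∈ α ω ∧ n + 2 ∈ α ω then
      (hawkinsY (α ω) n -
        (1 / ((n : ℝ) + 1)) * (1 - 1 / (n : ℝ)) * (hawkinsY (α ω) n) ^ 2)⁻¹ else 0) ∂μ =
      (1 - 1 / (n : ℝ)) * ∫ ω, hawkinsY (α ω) n ∂μ := by
  have hW := h.isBoundedBefore_weight hn
  simp only [piHat_summand_eq]
  set W : Ω → ℝ := fun ω => (if n ∈ α ω then 1 else 0) * (hawkinsY (α ω) n -
        (1 / ((n : ℝ) + 1)) * (1 - 1 / (n : ℝ)) * (hawkinsY (α ω) n) ^ 2)⁻¹ with hWdef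
  have hY : IsBoundedBefore α (n + 1) fun ω => hawkinsY (α ω) (n + 1) :=
    isBoundedBefore_comp_hawkinsY h.mem_ge_two (n + 1) measurable_id
  have hWY := hW.mul hY
  have hWYI := (hWY.mono (n + 1).le_succ).mul
    (isBoundedBefore_indicator α (by omega : 2 ≤ n + 1) (n + 1).lt_succ_self)
  have e1 := h.integral_mul_indicator (by omega) (hW.mono (n + 1).le_succ)
  have e2 := h.integral_mul_indicator (by omega) hWY
  have e3 : ∫ ω, Set.indicator {ω | n ∈ α ω} (fun _ => (1 : ℝ)) ω ∂μ =
      ∫ ω, hawkinsY (α ω) n ∂μ := by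
    simpa using h.integral_mul_indicator hn (g := fun _ => 1)
      ⟨measurable_const, 1, fun _ => by simp⟩
  have e4 : ∫ ω, W ω * hawkinsY (α ω) (n + 2) ∂μ =
      ∫ ω, W ω * hawkinsY (α ω) (n + 1) ∂μ - (1 / ((n : ℝ) + 1)) *
        ∫ ω, W ω * hawkinsY (α ω) (n + 1) * hawkinsY (α ω) (n + 1) ∂μ := by
    refine Eq.trans ?_ (congrArg (fun t => ∫ ω, W ω * hawkinsY (α ω) (n + 1) ∂μ -
      (1 / ((n : ℝ) + 1)) * t) e2)
    rw [← integral_const_mul, ← integral_sub (h.integrable hWY)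
      ((h.integrable hWYI).const_mul _)]
    refine integral_congr_ae (Eventually.of_forall fun ω => ?_)
    simp only [hawkinsY_succ _ (n + 1), indicator_mem_apply]
    split_ifs <;> push_cast <;> ring
  refine (e1.trans e4).trans ?_
  rw [← integral_const_mul, ← integral_sub (h.integrable hWY)
    ((h.integrable (hWY.mul hY)).const_mul _), ← e3, ← integral_const_mul]
  refine integral_congr_ae (Eventually.of_forall fun ω => ?_)
  have hy := hawkinsY_mem_Ioc (h.mem_ge_two ω) n
  simp only [hWdef, hawkinsY_succ _ n, indicator_mem_apply]
  split_ifs with hω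
  · set y := hawkinsY (α ω) n
    have hn' : (2 : ℝ) ≤ n := by exact_mod_cast hn
    have hc0 : 0 < 1 / (n : ℝ) := by positivity
    have hd0 : 0 < 1 / ((n : ℝ) + 1) := by positivity
    have hd1 : 1 / ((n : ℝ) + 1) < 1 := by rw [div_lt_one] <;> linarith
    have hc1 : 1 / (n : ℝ) < 1 := by rw [div_lt_one] <;> linarith
    set c := 1 / (n : ℝ)
    set d := 1 / ((n : ℝ) + 1)
    have hdc : d * (1 - c) < 1 := by nlinarith
    have hdc0 : 0 < d * (1 - c) := mul_pos hd0 (by linarith)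
    have hD : y - d * (1 - c) * y ^ 2 ≠ 0 := by
      have : 0 < y * (1 - d * (1 - c) * y) :=
        mul_pos hy.1 (by nlinarith [hy.1, hy.2])
      nlinarith
    linear_combination (1 - c) * mul_inv_cancel₀ hD
  · simp

end

theorem piHat_expectation_difference {Ω : Type*} [MeasurableSpace Ω] (μ : Measure Ω)
    (α : Ω → Set ℕ) (h : IsHawkinsSieve μ α) (m : ℕ) (hm : 2 ≤ m) :
    (∫ ω, piHat (α ω) (m + 1) ∂μ) - (∫ ω, piHat (α ω) m ∂μ) =
      (1 - 1 / ((m : ℝ) + 1)) * ∫ ω, hawkinsY (α ω) (m + 1) ∂μ := by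
  have hdiff : ∫ ω, piHat (α ω) (m + 1) ∂μ = ∫ ω, piHat (α ω) m ∂μ + _ :=
    (integral_congr_ae (Eventually.of_forall fun ω => Finset.sum_range_succ _ (m + 1))).trans
      (integral_add (integrable_finsetSum _ fun n _ => h.integrable_summand n)
        (h.integrable_summand (m + 1)))
  rw [hdiff, add_sub_cancel_left, h.integral_summand (by omega)]
  push_cast
  rfl
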